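/- arXiv:1512.04919 — 5 statements merged into one kernel-verified Lean document; each statement's English description precedes it below -/
import Mathlib

section
/- For all natural numbers p and q there is an isomorphism of ℝ-algebras Cl(p,q) ⊗_ℝ Cl(2,0) ≅ Cl(q+2, p). -/
open TensorProduct

/-- The quadratic form on ℝ^{p+q} with `p` plus signs and `q` minus signs. -/
noncomputable def Qpq (p q : ℕ) : QuadraticForm ℝ (Fin (p + q) → ℝ) :=
  QuadraticMap.weightedSumSquares ℝ (fun i : Fin (p + q) => if (i : ℕ) < p then (1 : ℝ) else -1)

/-- The real Clifford algebra `Cl(p,q)`. -/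
noncomputable def Cl (p q : ℕ) : Type :=
  CliffordAlgebra (Qpq p q)

noncomputable instance (p q : ℕ) : Ring (Cl p q) :=
  inferInstanceAs (Ring (CliffordAlgebra (Qpq p q)))

noncomputable instance (p q : ℕ) : Algebra ℝ (Cl p q) :=
  inferInstanceAs (Algebra ℝ (CliffordAlgebra (Qpq p q)))

namespace CliffordAlgebra

variable {R M₁ M₂ A : Type*} [CommRing R] [AddCommGroup M₁] [AddCommGroup M₂]
  [Module R M₁] [Module R M₂] [Ring A] [Algebra R A]
  {Q₁ : QuadraticForm R M₁} {Q₂ : QuadraticForm R M₂}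

/-- Two algebra maps out of Clifford algebras commute as soon as they commute on vectors. -/
theorem commute_of_commute_ι (f : CliffordAlgebra Q₁ →ₐ[R] A) (g : CliffordAlgebra Q₂ →ₐ[R] A)
    (h : ∀ v w, Commute (f (ι Q₁ v)) (g (ι Q₂ w))) (x : CliffordAlgebra Q₁)
    (y : CliffordAlgebra Q₂) : Commute (f x) (g y) := by
  induction x using CliffordAlgebra.induction with
  | algebraMap r => rw [AlgHom.commutes]; exact Algebra.commutes r _
  | mul a b ha hb => rw [map_mul]; exact ha.mul_left hb
  | add a b ha hb => rw [map_add]; exact ha.add_left hb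
  | ι v =>
    induction y using CliffordAlgebra.induction with
    | algebraMap r => rw [AlgHom.commutes]; exact (Algebra.commutes r _).symm
    | mul a b ha hb => rw [map_mul]; exact ha.mul_right hb
    | add a b ha hb => rw [map_add]; exact ha.add_right hb
    | ι w => exact h v w

section tensorEquiv

variable (Q₁) {ω : CliffordAlgebra Q₂} (hsq : ω * ω = -1)
  (hanti : ∀ x, ω * ι Q₂ x = -(ι Q₂ x * ω))

include hsq hanti in
theorem tensor_vector_sq (m : M₂ × M₁) :
    ((1 : CliffordAlgebra Q₁) ⊗ₜ[R] ι Q₂ m.1 + ι Q₁ m.2 ⊗ₜ[R] ω) *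
      ((1 : CliffordAlgebra Q₁) ⊗ₜ[R] ι Q₂ m.1 + ι Q₁ m.2 ⊗ₜ[R] ω) =
      algebraMap R _ ((Q₂.prod (-Q₁)) m) := by
  simp only [add_mul, mul_add, Algebra.TensorProduct.tmul_mul_tmul, one_mul, mul_one, hsq, hanti,
    ι_sq_scalar, TensorProduct.tmul_neg, QuadraticMap.prod_apply, _root_.neg_apply, map_add, map_neg]
  rw [← Algebra.TensorProduct.algebraMap_apply', Algebra.TensorProduct.algebraMap_apply]
  abel

/-- The map `Cl(Q₂ ⊕ -Q₁) → Cl(Q₁) ⊗ Cl(Q₂)` sending `(x, v)` to `1 ⊗ x + v ⊗ ω`. -/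
noncomputable def prodNegToTensor :
    CliffordAlgebra (Q₂.prod (-Q₁)) →ₐ[R] CliffordAlgebra Q₁ ⊗[R] CliffordAlgebra Q₂ :=
  lift _ ⟨LinearMap.coprod (TensorProduct.mk R _ _ 1 ∘ₗ ι Q₂)
    ((TensorProduct.mk R _ _).flip ω ∘ₗ ι Q₁), tensor_vector_sq Q₁ hsq hanti⟩

theorem prodNegToTensor_ι (m : M₂ × M₁) :
    prodNegToTensor Q₁ hsq hanti (ι _ m) = 1 ⊗ₜ ι Q₂ m.1 + ι Q₁ m.2 ⊗ₜ ω :=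
  lift_ι_apply _ _ _

variable (ω) in
/-- The image of `ω` in `Cl(Q₂ ⊕ -Q₁)`. -/
noncomputable abbrev prodNegVolume : CliffordAlgebra (Q₂.prod (-Q₁)) :=
  map (QuadraticMap.Isometry.inl Q₂ (-Q₁)) ω

theorem commute_ι_prodNegVolume (heven : ω ∈ evenOdd Q₂ 0) (v : M₁) :
    Commute (ι (Q₂.prod (-Q₁)) (0, v)) (prodNegVolume Q₁ ω) := by
  have := commute_map_mul_map_of_isOrtho_of_mem_evenOdd_zero_left
    (QuadraticMap.Isometry.inl Q₂ (-Q₁)) (QuadraticMap.Isometry.inr Q₂ (-Q₁))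
    (fun x y => QuadraticMap.IsOrtho.inl_inr x y) ω (ι _ v) heven (ι_mem_evenOdd_one _ v)
  rw [map_apply_ι] at this
  exact this.symm

include hsq in
theorem prodNegVolume_sq : prodNegVolume Q₁ ω * prodNegVolume Q₁ ω = -1 := by
  rw [← map_mul, hsq, map_neg, map_one]

include hanti in
theorem prodNegVolume_mul_ι (x : M₂) :
    prodNegVolume Q₁ ω * ι (Q₂.prod (-Q₁)) (x, 0) =
      -(ι (Q₂.prod (-Q₁)) (x, 0) * prodNegVolume Q₁ ω) := by
  have := congrArg (map (QuadraticMap.Isometry.inl Q₂ (-Q₁))) (hanti x)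
  rwa [map_neg, map_mul, map_mul, map_apply_ι] at this

/-- The map `Cl(Q₁) → Cl(Q₂ ⊕ -Q₁)` sending `v` to `-vω`. -/
noncomputable def leftToProdNeg (heven : ω ∈ evenOdd Q₂ 0) :
    CliffordAlgebra Q₁ →ₐ[R] CliffordAlgebra (Q₂.prod (-Q₁)) :=
  lift _ ⟨-(LinearMap.mulRight R (prodNegVolume Q₁ ω) ∘ₗ ι _ ∘ₗ LinearMap.inr R M₂ M₁),
    fun v => by
      change -(ι (Q₂.prod (-Q₁)) (0, v) * _) * -(ι _ (0, v) * _) = _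
      rw [neg_mul_neg, (commute_ι_prodNegVolume Q₁ heven v).symm.mul_mul_mul_comm,
        prodNegVolume_sq Q₁ hsq, ι_sq_scalar]
      simp⟩

theorem leftToProdNeg_ι (heven : ω ∈ evenOdd Q₂ 0) (v : M₁) :
    leftToProdNeg Q₁ hsq heven (ι _ v) = -(ι _ (0, v) * prodNegVolume Q₁ ω) :=
  lift_ι_apply _ _ _

include hanti in
theorem commute_leftToProdNeg (heven : ω ∈ evenOdd Q₂ 0) (x : CliffordAlgebra Q₁)
    (y : CliffordAlgebra Q₂) :
    Commute (leftToProdNeg Q₁ hsq heven x) (map (QuadraticMap.Isometry.inl Q₂ (-Q₁)) y) := by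
  refine commute_of_commute_ι _ _ (fun v w => ?_) x y
  rw [leftToProdNeg_ι, map_apply_ι]
  refine Commute.neg_left ?_
  change _ * ι (Q₂.prod (-Q₁)) (w, 0) = ι (Q₂.prod (-Q₁)) (w, 0) * _
  rw [mul_assoc, prodNegVolume_mul_ι Q₁ hanti, mul_neg, ← mul_assoc,
    ι_mul_ι_comm_of_isOrtho (QuadraticMap.IsOrtho.inr_inl w v), neg_mul, neg_neg, mul_assoc]

/-- If `ω` is an even element of `Cl(Q₂)` with `ω² = -1` anticommuting with all vectors, then
`Cl(Q₁) ⊗ Cl(Q₂)` is the Clifford algebra of `Q₂ ⊕ -Q₁`. -/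
noncomputable def tensorEquivProdNeg (heven : ω ∈ evenOdd Q₂ 0) :
    CliffordAlgebra Q₁ ⊗[R] CliffordAlgebra Q₂ ≃ₐ[R] CliffordAlgebra (Q₂.prod (-Q₁)) :=
  have hright (y : CliffordAlgebra Q₂) : prodNegToTensor Q₁ hsq hanti
      (map (QuadraticMap.Isometry.inl Q₂ (-Q₁)) y) = 1 ⊗ₜ y := by
    refine DFunLike.congr_fun (f := (prodNegToTensor Q₁ hsq hanti).comp (map _))
      (g := Algebra.TensorProduct.includeRight) (hom_ext (LinearMap.ext fun x => ?_)) y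
    simp [prodNegToTensor_ι]
  AlgEquiv.ofAlgHom
    (Algebra.TensorProduct.lift (leftToProdNeg Q₁ hsq heven)
      (map (QuadraticMap.Isometry.inl Q₂ (-Q₁))) (commute_leftToProdNeg Q₁ hsq hanti heven))
    (prodNegToTensor Q₁ hsq hanti)
    (by
      refine hom_ext (LinearMap.ext fun m => ?_)
      obtain ⟨x, v⟩ := m
      change Algebra.TensorProduct.lift _ _ (commute_leftToProdNeg Q₁ hsq hanti heven)
        (prodNegToTensor Q₁ hsq hanti (ι _ (x, v))) =
        ι _ (x, v)
      rw [prodNegToTensor_ι, map_add, Algebra.TensorProduct.lift_tmul,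
        Algebra.TensorProduct.lift_tmul, leftToProdNeg_ι, map_apply_ι, neg_mul, mul_assoc,
        prodNegVolume_sq Q₁ hsq, map_one, one_mul, mul_neg_one, neg_neg]
      simp [← map_add])
    (by
      refine Algebra.TensorProduct.ext (hom_ext (LinearMap.ext fun v => ?_))
        (AlgHom.ext fun y => ?_)
      · change prodNegToTensor Q₁ hsq hanti (Algebra.TensorProduct.lift _ _
          (commute_leftToProdNeg Q₁ hsq hanti heven) (ι Q₁ v ⊗ₜ 1)) =
          ι Q₁ v ⊗ₜ 1
        rw [Algebra.TensorProduct.lift_tmul, map_one, mul_one, leftToProdNeg_ι, map_neg, map_mul,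
          hright, prodNegToTensor_ι]
        simp [hsq, TensorProduct.tmul_neg]
      · change prodNegToTensor Q₁ hsq hanti (Algebra.TensorProduct.lift _ _
          (commute_leftToProdNeg Q₁ hsq hanti heven) (1 ⊗ₜ y)) = 1 ⊗ₜ y
        rw [Algebra.TensorProduct.lift_tmul, map_one, one_mul, hright])

end tensorEquiv

/-- For orthogonal vectors `a`, `b` with `a² = b² = 1`, the bivector `ab` squares to `-1`. -/
theorem ι_mul_ι_sq_of_isOrtho {a b : M₂} (h : Q₂.IsOrtho a b) (ha : Q₂ a = 1) (hb : Q₂ b = 1) :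
    ι Q₂ a * ι Q₂ b * (ι Q₂ a * ι Q₂ b) = -1 := by
  rw [mul_ι_mul_ι_mul_comm_of_isOrtho _ h.symm, ι_sq_scalar, ι_sq_scalar, ha, hb]
  simp

/-- For orthogonal vectors `a`, `b`, the bivector `ab` anticommutes with their span. -/
theorem ι_mul_ι_mul_ι_add_smul_of_isOrtho {a b : M₂} (h : Q₂.IsOrtho a b) (r s : R) :
    ι Q₂ a * ι Q₂ b * ι Q₂ (r • a + s • b) = -(ι Q₂ (r • a + s • b) * (ι Q₂ a * ι Q₂ b)) := by
  have hba := ι_mul_ι_comm_of_isOrtho h.symm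
  have h₁ : ι Q₂ a * ι Q₂ b * ι Q₂ a = -(ι Q₂ a * (ι Q₂ a * ι Q₂ b)) := by
    rw [mul_assoc, hba, mul_neg]
  have h₂ : ι Q₂ a * ι Q₂ b * ι Q₂ b = -(ι Q₂ b * (ι Q₂ a * ι Q₂ b)) := by
    rw [← mul_assoc (ι Q₂ b), hba, neg_mul, neg_neg]
  simp only [map_add, map_smul, mul_add, add_mul, mul_smul_comm, smul_mul_assoc, h₁, h₂, smul_neg,
    neg_add]

end CliffordAlgebra

/-- The index bijection underlying the isometry of `Q_{q+2,p}` with `Q_{2,0} ⊕ -Q_{p,q}`. -/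
def indexEquiv (p q : ℕ) : Fin (q + 2 + p) ≃ Fin (2 + 0) ⊕ Fin (p + q) :=
  finSumFinEquiv.symm.trans <| (Equiv.sumCongr (finSumFinEquiv.symm.trans (Equiv.sumComm _ _))
    (Equiv.refl _)).trans <| (Equiv.sumAssoc _ _ _).trans <|
    Equiv.sumCongr (Equiv.refl _) ((Equiv.sumComm _ _).trans finSumFinEquiv)

/-- `Q_{2,0} ⊕ -Q_{p,q}` is isometric to `Q_{q+2,p}`. -/
noncomputable def QpqProdNegIsometry (p q : ℕ) :
    ((Qpq 2 0).prod (-Qpq p q)).IsometryEquiv (Qpq (q + 2) p) where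
  toLinearEquiv := (LinearEquiv.sumArrowLequivProdArrow _ _ ℝ ℝ).symm.trans
    (LinearEquiv.funCongrLeft ℝ ℝ (indexEquiv p q))
  map_app' := by
    rintro ⟨x, v⟩
    change Qpq (q + 2) p (fun i => Sum.elim x v (indexEquiv p q i)) = Qpq 2 0 x + -Qpq p q v
    simp only [Qpq, QuadraticMap.weightedSumSquares_apply, Fin.sum_univ_add]
    have hq (i : Fin q) : (i : ℕ) < q + 2 := by omega
    have hp (i : Fin q) : ¬ p + (i : ℕ) < p := by omega
    have hr (i : Fin p) : ¬ q + 2 + (i : ℕ) < q + 2 := by omega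
    simp [indexEquiv, Fin.sum_univ_two, hq, hp, hr]
    ring

theorem Qpq_two_zero_apply (x : Fin (2 + 0) → ℝ) : Qpq 2 0 x = x 0 * x 0 + x 1 * x 1 := by
  simp [Qpq, QuadraticMap.weightedSumSquares_apply, Fin.sum_univ_two]

theorem Qpq_two_zero_isOrtho : (Qpq 2 0).IsOrtho (Pi.single 0 1) (Pi.single 1 1) := by
  simp [QuadraticMap.isOrtho_def, Qpq_two_zero_apply]

open CliffordAlgebra in
/-- `Cl(p,q) ⊗_ℝ Cl(2,0) ≅ Cl(q+2, p)` as ℝ-algebras. -/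
theorem clifford_tensor_cl20 (p q : ℕ) :
    Nonempty ((Cl p q ⊗[ℝ] Cl 2 0) ≃ₐ[ℝ] Cl (q + 2) p) := by
  have hsq := ι_mul_ι_sq_of_isOrtho Qpq_two_zero_isOrtho
    (by simp [Qpq_two_zero_apply]) (by simp [Qpq_two_zero_apply])
  refine ⟨(tensorEquivProdNeg (Qpq p q) hsq (fun x => ?_) (ι_mul_ι_mem_evenOdd_zero _ _ _)).trans
    (equivOfIsometry (QpqProdNegIsometry p q))⟩
  have hx : x = x 0 • Pi.single 0 1 + x 1 • Pi.single 1 1 := by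
    ext i
    fin_cases i <;> simp
  rw [hx]
  exact ι_mul_ι_mul_ι_add_smul_of_isOrtho Qpq_two_zero_isOrtho _ _
end

section
/- For all natural numbers p and q there is an isomorphism of ℝ-algebras Cl(p,q) ⊗_ℝ Cl(1,1) ≅ Cl(p+1, q+1). -/
open TensorProduct

namespace CliffordAlgebra

section TensorProduct

variable {R M₁ M₂ : Type*} [CommRing R] [AddCommGroup M₁] [AddCommGroup M₂]
variable [Module R M₁] [Module R M₂]
variable {Q₁ : QuadraticForm R M₁} {Q₂ : QuadraticForm R M₂}

theorem commute_algHom_of_commute_ι {A : Type*} [Ring A] [Algebra R A]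
    (f : CliffordAlgebra Q₁ →ₐ[R] A) (g : CliffordAlgebra Q₂ →ₐ[R] A)
    (h : ∀ m₁ m₂, Commute (f (ι Q₁ m₁)) (g (ι Q₂ m₂)))
    (x : CliffordAlgebra Q₁) (y : CliffordAlgebra Q₂) : Commute (f x) (g y) := by
  induction x using CliffordAlgebra.induction with
  | algebraMap r => rw [AlgHom.commutes]; exact Algebra.commute_algebraMap_left _ _
  | add a b ha hb => rw [map_add]; exact ha.add_left hb
  | mul a b ha hb => rw [map_mul]; exact ha.mul_left hb
  | ι m =>
    induction y using CliffordAlgebra.induction with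
    | algebraMap r => rw [AlgHom.commutes]; exact Algebra.commute_algebraMap_right _ _
    | add a b ha hb => rw [map_add]; exact ha.add_right hb
    | mul a b ha hb => rw [map_mul]; exact ha.mul_right hb
    | ι m₂ => exact h m m₂

variable {ω : CliffordAlgebra Q₂}

variable (Q₁) in
/-- The algebra map sending `(m₁, m₂)` to `m₁ ⊗ ω + 1 ⊗ m₂`, where `ω` squares to one and
anticommutes with all vectors. -/
noncomputable def prodToTensor (hω : ω * ω = 1) (hanti : ∀ m, ω * ι Q₂ m = -(ι Q₂ m * ω)) :
    CliffordAlgebra (Q₁.prod Q₂) →ₐ[R] CliffordAlgebra Q₁ ⊗[R] CliffordAlgebra Q₂ :=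
  lift (Q₁.prod Q₂) ⟨LinearMap.coprod ((TensorProduct.mk R _ _).flip ω ∘ₗ ι Q₁)
    (TensorProduct.mk R _ _ 1 ∘ₗ ι Q₂), fun m ↦ by
      simp only [LinearMap.coprod_apply, LinearMap.comp_apply, LinearMap.flip_apply,
        TensorProduct.mk_apply, mul_add, add_mul, Algebra.TensorProduct.tmul_mul_tmul,
        ι_sq_scalar, hω, hanti, one_mul, mul_one, tmul_neg, QuadraticMap.prod_apply, map_add,
        Algebra.algebraMap_eq_smul_one, smul_tmul,
        tmul_smul]
      abel⟩

theorem prodToTensor_ι (hω : ω * ω = 1) (hanti : ∀ m, ω * ι Q₂ m = -(ι Q₂ m * ω))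
    (m : M₁ × M₂) :
    prodToTensor Q₁ hω hanti (ι _ m) = ι Q₁ m.1 ⊗ₜ[R] ω + 1 ⊗ₜ[R] ι Q₂ m.2 := by
  rw [prodToTensor, lift_ι_apply]
  rfl

theorem prodToTensor_map_inr (hω : ω * ω = 1) (hanti : ∀ m, ω * ι Q₂ m = -(ι Q₂ m * ω))
    (x : CliffordAlgebra Q₂) :
    prodToTensor Q₁ hω hanti (map (QuadraticMap.Isometry.inr Q₁ Q₂) x) = 1 ⊗ₜ[R] x := by
  have h : (prodToTensor Q₁ hω hanti).comp (map (QuadraticMap.Isometry.inr Q₁ Q₂)) =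
      Algebra.TensorProduct.includeRight := by
    ext m
    simp [prodToTensor_ι]
  exact DFunLike.congr_fun h x

theorem commute_ι_inl_map_inr (heven : ω ∈ evenOdd Q₂ 0) (m : M₁) :
    Commute (ι (Q₁.prod Q₂) (m, 0)) (map (QuadraticMap.Isometry.inr Q₁ Q₂) ω) := by
  have h := commute_map_mul_map_of_isOrtho_of_mem_evenOdd_zero_right
    (QuadraticMap.Isometry.inl Q₁ Q₂) (QuadraticMap.Isometry.inr Q₁ Q₂)
    (fun x y ↦ by simp) (ι Q₁ m) ω (ι_mem_evenOdd_one Q₁ m) heven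
  simpa using h

variable (Q₁) in
/-- The algebra map sending a vector `m` to `m * ω`, where `ω` is even and squares to one. -/
noncomputable def twistedInl (hω : ω * ω = 1) (heven : ω ∈ evenOdd Q₂ 0) :
    CliffordAlgebra Q₁ →ₐ[R] CliffordAlgebra (Q₁.prod Q₂) :=
  lift Q₁ ⟨LinearMap.mulRight R (map (QuadraticMap.Isometry.inr Q₁ Q₂) ω) ∘ₗ
    ι (Q₁.prod Q₂) ∘ₗ LinearMap.inl R M₁ M₂, fun m ↦ by
      simp only [LinearMap.comp_apply, LinearMap.mulRight_apply, LinearMap.inl_apply]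
      rw [(commute_ι_inl_map_inr heven m).symm.mul_mul_mul_comm, ← map_mul (map _), hω, ι_sq_scalar]
      simp⟩

theorem twistedInl_ι (hω : ω * ω = 1) (heven : ω ∈ evenOdd Q₂ 0) (m : M₁) :
    twistedInl Q₁ hω heven (ι Q₁ m) =
      ι (Q₁.prod Q₂) (m, 0) * map (QuadraticMap.Isometry.inr Q₁ Q₂) ω := by
  simp [twistedInl]

theorem commute_twistedInl_map_inr (hω : ω * ω = 1) (heven : ω ∈ evenOdd Q₂ 0)
    (hanti : ∀ m, ω * ι Q₂ m = -(ι Q₂ m * ω)) (x : CliffordAlgebra Q₁)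
    (y : CliffordAlgebra Q₂) :
    Commute (twistedInl Q₁ hω heven x) (map (QuadraticMap.Isometry.inr Q₁ Q₂) y) := by
  refine commute_algHom_of_commute_ι _ _ (fun m₁ m₂ ↦ ?_) x y
  rw [twistedInl_ι, commute_iff_eq, mul_assoc, ← map_mul, hanti, map_neg, map_mul, mul_neg,
    ← mul_assoc, ← mul_assoc, map_apply_ι, ← neg_mul]
  congr 1
  exact (ι_mul_ι_comm_of_isOrtho (QuadraticMap.IsOrtho.inr_inl (Q₁ := Q₁) (Q₂ := Q₂) m₁ m₂)).symm

/-- If `CliffordAlgebra Q₂` has an even element which squares to one and anticommutes with all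
vectors, then the ungraded tensor product with it is the Clifford algebra of the product form. -/
noncomputable def tensorEquivProd (hω : ω * ω = 1) (heven : ω ∈ evenOdd Q₂ 0)
    (hanti : ∀ m, ω * ι Q₂ m = -(ι Q₂ m * ω)) :
    CliffordAlgebra Q₁ ⊗[R] CliffordAlgebra Q₂ ≃ₐ[R] CliffordAlgebra (Q₁.prod Q₂) :=
  AlgEquiv.ofAlgHom
    (Algebra.TensorProduct.lift (twistedInl Q₁ hω heven)
      (map (QuadraticMap.Isometry.inr Q₁ Q₂)) (commute_twistedInl_map_inr hω heven hanti))
    (prodToTensor Q₁ hω hanti)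
    (by
      ext m
      · simp [prodToTensor_ι, twistedInl_ι, mul_assoc, ← map_mul (map _), hω]
      · simp [prodToTensor_ι])
    (by
      ext m
      · simp [twistedInl_ι, prodToTensor_ι, prodToTensor_map_inr, hω]
      · simp [prodToTensor_ι])

end TensorProduct

end CliffordAlgebra

/-- The equivalence of index types matching positive and negative coordinates. -/
def signatureIndexEquiv (p q r s : ℕ) :
    Fin (p + q) ⊕ Fin (r + s) ≃ Fin ((p + r) + (q + s)) :=
  (Equiv.sumCongr finSumFinEquiv.symm finSumFinEquiv.symm).trans <|
    (Equiv.sumSumSumComm _ _ _ _).trans <|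
      (Equiv.sumCongr finSumFinEquiv finSumFinEquiv).trans finSumFinEquiv

theorem signatureIndexEquiv_inl_lt_iff {p q r s : ℕ} (i : Fin (p + q)) :
    (signatureIndexEquiv p q r s (.inl i) : ℕ) < p + r ↔ (i : ℕ) < p := by
  obtain ⟨i | i, rfl⟩ := finSumFinEquiv.surjective i
  · simp [signatureIndexEquiv]; omega
  · simp [signatureIndexEquiv]

theorem signatureIndexEquiv_inr_lt_iff {p q r s : ℕ} (i : Fin (r + s)) :
    (signatureIndexEquiv p q r s (.inr i) : ℕ) < p + r ↔ (i : ℕ) < r := by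
  obtain ⟨i | i, rfl⟩ := finSumFinEquiv.surjective i
  · simp [signatureIndexEquiv]
  · simp [signatureIndexEquiv]

/-- The orthogonal sum of standard forms is standard, with the signatures added. -/
noncomputable def QpqProdIsometryEquiv (p q r s : ℕ) :
    ((Qpq p q).prod (Qpq r s)).IsometryEquiv (Qpq (p + r) (q + s)) where
  toLinearEquiv := (LinearEquiv.sumArrowLequivProdArrow _ _ ℝ ℝ).symm.trans
    (LinearEquiv.funCongrLeft ℝ ℝ (signatureIndexEquiv p q r s).symm)
  map_app' v := by
    change Qpq (p + r) (q + s) _ = _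
    simp only [Qpq, QuadraticMap.prod_apply, QuadraticMap.weightedSumSquares_apply]
    rw [← (signatureIndexEquiv p q r s).sum_comp]
    cases v
    simp [signatureIndexEquiv_inl_lt_iff, signatureIndexEquiv_inr_lt_iff,
      LinearEquiv.funCongrLeft_apply, LinearMap.funLeft_apply]

theorem exists_even_involution_Qpq_one_one :
    ∃ ω ∈ CliffordAlgebra.evenOdd (Qpq 1 1) 0, ω * ω = 1 ∧
      ∀ m, ω * CliffordAlgebra.ι (Qpq 1 1) m = -(CliffordAlgebra.ι (Qpq 1 1) m * ω) := by
  set e := CliffordAlgebra.ι (Qpq 1 1) ![1, 0] with he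
  set f := CliffordAlgebra.ι (Qpq 1 1) ![0, 1] with hf
  have hee : e * e = 1 := by
    have hQ : Qpq 1 1 ![1, 0] = 1 := by simp [Qpq, QuadraticMap.weightedSumSquares_apply]
    rw [he, CliffordAlgebra.ι_sq_scalar, hQ, map_one]
  have hff : f * f = -1 := by
    have hQ : Qpq 1 1 ![0, 1] = -1 := by simp [Qpq, QuadraticMap.weightedSumSquares_apply]
    rw [hf, CliffordAlgebra.ι_sq_scalar, hQ, map_neg, map_one]
  have hfe : f * e = -(e * f) := by
    refine CliffordAlgebra.ι_mul_ι_comm_of_isOrtho ?_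
    simp [QuadraticMap.isOrtho_def, Qpq, QuadraticMap.weightedSumSquares_apply]
  have hι (m : Fin (1 + 1) → ℝ) : CliffordAlgebra.ι (Qpq 1 1) m = m 0 • e + m 1 • f := by
    rw [he, hf, ← map_smul, ← map_smul, ← map_add]
    congr 1
    ext i
    fin_cases i <;> simp
  have hωe : e * f * e = -(e * (e * f)) := by rw [mul_assoc, hfe, mul_neg]
  have hωf : e * f * f = -(f * (e * f)) := by
    rw [← mul_assoc f, hfe, neg_mul, neg_neg]
  refine ⟨e * f, CliffordAlgebra.ι_mul_ι_mem_evenOdd_zero _ _ _, ?_, fun m ↦ ?_⟩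
  · rw [← mul_assoc, hωe, ← mul_assoc, hee, one_mul, neg_mul, hff, neg_neg]
  · rw [hι, mul_add, add_mul, mul_smul_comm, mul_smul_comm, smul_mul_assoc, smul_mul_assoc,
      hωe, hωf, smul_neg, smul_neg, neg_add]

/-- `Cl(p,q) ⊗_ℝ Cl(1,1) ≅ Cl(p+1, q+1)` as ℝ-algebras. -/
theorem clifford_tensor_cl11 (p q : ℕ) :
    Nonempty ((Cl p q ⊗[ℝ] Cl 1 1) ≃ₐ[ℝ] Cl (p + 1) (q + 1)) := by
  obtain ⟨ω, heven, hω, hanti⟩ := exists_even_involution_Qpq_one_one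
  exact ⟨(CliffordAlgebra.tensorEquivProd (Q₁ := Qpq p q) hω heven hanti).trans
    (CliffordAlgebra.equivOfIsometry (QpqProdIsometryEquiv p q 1 1))⟩
end

section
/- For every natural number k there is an isomorphism of ℂ-algebras Cl^c(2k) ≅ M_{2^k}(ℂ): the complex Clifford algebra on 2k generators is the full matrix algebra of complex 2^k × 2^k matrices. -/
/-- The quadratic form `Q(v) = Σ v_i²` on ℂⁿ. -/
noncomputable def Qc (n : ℕ) : QuadraticForm ℂ (Fin n → ℂ) :=
  QuadraticMap.weightedSumSquares ℂ (fun _ : Fin n => (1 : ℂ))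

/-- The complex Clifford algebra `Cl^c(n)`. -/
noncomputable def Clc (n : ℕ) : Type :=
  CliffordAlgebra (Qc n)

noncomputable instance (n : ℕ) : Ring (Clc n) :=
  inferInstanceAs (Ring (CliffordAlgebra (Qc n)))

noncomputable instance (n : ℕ) : Algebra ℂ (Clc n) :=
  inferInstanceAs (Algebra ℂ (CliffordAlgebra (Qc n)))

open CliffordAlgebra

section

variable {R A B n : Type*} [CommRing R] [Ring A] [Algebra R A] [Ring B] [Algebra R B]
  [Fintype n] [DecidableEq n]

/-- An algebra map `A → B` whose image commutes with a system of matrix units of `B` extends to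
an algebra map from the matrices over `A`. -/
noncomputable def matrixUnitsLift (j : A →ₐ[R] B) (E : n → n → B)
    (hE : ∀ i k l m, E i k * E l m = if k = l then E i m else 0) (hE1 : ∑ i, E i i = 1)
    (hj : ∀ a i k, Commute (j a) (E i k)) : Matrix n n A →ₐ[R] B :=
  AlgHom.ofLinearMap
    { toFun := fun M => ∑ i, ∑ k, j (M i k) * E i k
      map_add' := fun M N => by simp [add_mul, Finset.sum_add_distrib]
      map_smul' := fun r M => by simp [Finset.smul_sum] }
    (by
      have h (i k : n) : j ((1 : Matrix n n A) i k) * E i k = if i = k then E i i else 0 := by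
        by_cases hik : i = k
        · subst hik; simp
        · simp [hik]
      simp [h, hE1])
    (fun M N => by
      have h (a b : A) (i k l m : n) : j a * E i k * (j b * E l m) =
          if k = l then j (a * b) * E i m else 0 := by
        rw [mul_assoc, ← mul_assoc (E i k), ← (hj b i k).eq, mul_assoc (j b), hE, ← mul_assoc,
          ← map_mul, mul_ite, mul_zero]
      simp only [LinearMap.coe_mk, AddHom.coe_mk, Matrix.mul_apply, map_sum, Finset.sum_mul]
      refine Finset.sum_congr rfl fun i _ => ?_
      rw [Finset.sum_comm]
      refine Finset.sum_congr rfl fun k _ => ?_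
      simp [Finset.mul_sum, h, Finset.sum_ite_irrel])

lemma matrixUnitsLift_apply (j : A →ₐ[R] B) (E : n → n → B)
    (hE : ∀ i k l m, E i k * E l m = if k = l then E i m else 0) (hE1 : ∑ i, E i i = 1)
    (hj : ∀ a i k, Commute (j a) (E i k)) (M : Matrix n n A) :
    matrixUnitsLift j E hE hE1 hj M = ∑ i, ∑ k, j (M i k) * E i k := rfl

end

namespace CliffordAlgebra

variable {R M : Type*} [CommRing R] [AddCommGroup M] [Module R M] (Q : QuadraticForm R M)

/-- The orthogonal sum of a hyperbolic plane and `Q`. -/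
def addHyperbolic : QuadraticForm R ((R × R) × M) :=
  (QuadraticMap.linMulLin (LinearMap.fst R R R) (LinearMap.snd R R R)).prod Q

@[simp]
lemma addHyperbolic_apply (v : (R × R) × M) : addHyperbolic Q v = v.1.1 * v.1.2 + Q v.2 := by
  simp [addHyperbolic]

/-- The algebra map to `2 × 2` matrices under which the hyperbolic plane is spanned by the
off-diagonal matrix units. -/
noncomputable def toMatrix :
    CliffordAlgebra (addHyperbolic Q) →ₐ[R] Matrix (Fin 2) (Fin 2) (CliffordAlgebra Q) :=
  lift (addHyperbolic Q) ⟨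
    { toFun := fun v => !![ι Q v.2, algebraMap R _ v.1.1; algebraMap R _ v.1.2, -ι Q v.2]
      map_add' := fun v w => by ext i k; fin_cases i <;> fin_cases k <;> simp [add_comm]
      map_smul' := fun r v => by ext i k; fin_cases i <;> fin_cases k <;> simp [Algebra.smul_def] },
    fun v => by
      have h1 := Algebra.commutes v.1.1 (ι Q v.2)
      have h2 := Algebra.commutes v.1.2 (ι Q v.2)
      have h3 := Algebra.commutes v.1.1 (algebraMap R (CliffordAlgebra Q) v.1.2)
      ext i k
      fin_cases i <;> fin_cases k <;>
        simp [Matrix.mul_apply, Matrix.algebraMap_matrix_apply, h1, h2, h3, add_comm]⟩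

lemma toMatrix_ι (v : (R × R) × M) : toMatrix Q (ι _ v) =
    !![ι Q v.2, algebraMap R _ v.1.1; algebraMap R _ v.1.2, -ι Q v.2] := by
  simp [toMatrix]

/-- The first isotropic generator of the hyperbolic plane. -/
noncomputable abbrev hypE : CliffordAlgebra (addHyperbolic Q) := ι _ ((1, 0), 0)

/-- The second isotropic generator of the hyperbolic plane. -/
noncomputable abbrev hypF : CliffordAlgebra (addHyperbolic Q) := ι _ ((0, 1), 0)

lemma hypE_mul_self : hypE Q * hypE Q = 0 := by simp [ι_sq_scalar]

lemma hypF_mul_self : hypF Q * hypF Q = 0 := by simp [ι_sq_scalar]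

lemma hypF_mul_hypE : hypF Q * hypE Q = 1 - hypE Q * hypF Q := by
  rw [eq_sub_iff_add_eq, ι_mul_ι_add_swap]
  simp [QuadraticMap.polar]

lemma ι_mul_hypE (m : M) : ι (addHyperbolic Q) (0, m) * hypE Q = -(hypE Q * ι _ (0, m)) :=
  ι_mul_ι_comm_of_isOrtho (.inr_inl _ _)

lemma ι_mul_hypF (m : M) : ι (addHyperbolic Q) (0, m) * hypF Q = -(hypF Q * ι _ (0, m)) :=
  ι_mul_ι_comm_of_isOrtho (.inr_inl _ _)

lemma hypE_mul_hypF_mul_hypE : hypE Q * hypF Q * hypE Q = hypE Q := by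
  rw [mul_assoc, hypF_mul_hypE, mul_sub, ← mul_assoc, hypE_mul_self]; simp

lemma hypF_mul_hypE_mul_hypF : hypF Q * hypE Q * hypF Q = hypF Q := by
  rw [hypF_mul_hypE, sub_mul, mul_assoc, hypF_mul_self]; simp

/-- The chirality element of the hyperbolic plane. -/
noncomputable def hypChir : CliffordAlgebra (addHyperbolic Q) := hypE Q * hypF Q - hypF Q * hypE Q

lemma hypChir_mul_hypE : hypChir Q * hypE Q = hypE Q := by
  rw [hypChir, sub_mul, hypE_mul_hypF_mul_hypE, mul_assoc, hypE_mul_self]; simp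

lemma hypE_mul_hypChir : hypE Q * hypChir Q = -hypE Q := by
  rw [hypChir, mul_sub, ← mul_assoc, ← mul_assoc, hypE_mul_hypF_mul_hypE, hypE_mul_self]; simp

lemma hypChir_mul_hypF : hypChir Q * hypF Q = -hypF Q := by
  rw [hypChir, sub_mul, hypF_mul_hypE_mul_hypF, mul_assoc, hypF_mul_self]; simp

lemma hypF_mul_hypChir : hypF Q * hypChir Q = hypF Q := by
  rw [hypChir, mul_sub, ← mul_assoc, ← mul_assoc, hypF_mul_hypE_mul_hypF, hypF_mul_self]; simp

lemma hypChir_mul_self : hypChir Q * hypChir Q = 1 := by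
  nth_rw 2 [hypChir]
  rw [mul_sub, ← mul_assoc, ← mul_assoc, hypChir_mul_hypE, hypChir_mul_hypF, neg_mul,
    hypF_mul_hypE]
  simp

lemma commute_ι_hypE_mul_hypF (m : M) :
    Commute (ι (addHyperbolic Q) (0, m)) (hypE Q * hypF Q) := by
  rw [Commute, SemiconjBy, ← mul_assoc, ι_mul_hypE, neg_mul, mul_assoc, ι_mul_hypF, mul_neg,
    neg_neg, mul_assoc]

lemma commute_ι_hypChir (m : M) : Commute (ι (addHyperbolic Q) (0, m)) (hypChir Q) := by
  have h := commute_ι_hypE_mul_hypF Q m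
  rw [hypChir, hypF_mul_hypE]
  exact h.sub_right ((Commute.one_right _).sub_right h)

/-- The embedding of the Clifford algebra of `Q` as the centralizer of the hyperbolic plane. -/
noncomputable def toCentralizer : CliffordAlgebra Q →ₐ[R] CliffordAlgebra (addHyperbolic Q) :=
  lift Q ⟨LinearMap.mulRight R (hypChir Q) ∘ₗ ι (addHyperbolic Q) ∘ₗ LinearMap.inr R (R × R) M,
    fun m => by
      simp only [LinearMap.comp_apply, LinearMap.mulRight_apply, LinearMap.inr_apply]
      rw [mul_assoc, ← (commute_ι_hypChir Q m).left_comm, hypChir_mul_self, mul_one, ι_sq_scalar]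
      simp⟩

lemma toCentralizer_ι (m : M) : toCentralizer Q (ι Q m) = ι _ (0, m) * hypChir Q := by
  simp [toCentralizer]

lemma commute_toCentralizer {x : CliffordAlgebra (addHyperbolic Q)}
    (hx : ∀ m, Commute (ι _ (0, m) * hypChir Q) x) (a : CliffordAlgebra Q) :
    Commute (toCentralizer Q a) x := by
  induction a using CliffordAlgebra.induction with
  | algebraMap r => rw [AlgHom.commutes]; exact Algebra.commutes r x
  | ι m => rw [toCentralizer_ι]; exact hx m
  | add a b ha hb => rw [map_add]; exact ha.add_left hb
  | mul a b ha hb => rw [map_mul]; exact ha.mul_left hb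

lemma commute_toCentralizer_hypE (a : CliffordAlgebra Q) :
    Commute (toCentralizer Q a) (hypE Q) :=
  commute_toCentralizer Q (fun m => by
    rw [Commute, SemiconjBy, mul_assoc, hypChir_mul_hypE, ← mul_assoc, ι_mul_hypE,
      ← neg_eq_iff_eq_neg.mpr (ι_mul_hypE Q m), neg_mul, mul_assoc, hypE_mul_hypChir, mul_neg,
      neg_neg, ι_mul_hypE]) a

lemma commute_toCentralizer_hypF (a : CliffordAlgebra Q) :
    Commute (toCentralizer Q a) (hypF Q) :=
  commute_toCentralizer Q (fun m => by
    rw [Commute, SemiconjBy, mul_assoc, hypChir_mul_hypF, ← mul_assoc, mul_neg, ι_mul_hypF,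
      ← neg_eq_iff_eq_neg.mpr (ι_mul_hypF Q m), neg_mul, mul_assoc, hypF_mul_hypChir, neg_neg,
      ι_mul_hypF]) a

/-- The matrix units generated by the hyperbolic plane. -/
noncomputable def hypUnits : Fin 2 → Fin 2 → CliffordAlgebra (addHyperbolic Q) :=
  !![hypE Q * hypF Q, hypE Q; hypF Q, hypF Q * hypE Q]

/-- The inverse of `toMatrix`. -/
noncomputable def ofMatrix :
    Matrix (Fin 2) (Fin 2) (CliffordAlgebra Q) →ₐ[R] CliffordAlgebra (addHyperbolic Q) :=
  matrixUnitsLift (toCentralizer Q) (hypUnits Q)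
    (fun i k l m => by
      have h1 := hypE_mul_hypF_mul_hypE Q
      have h2 := hypF_mul_hypE_mul_hypF Q
      have h3 := hypE_mul_self Q
      have h4 := hypF_mul_self Q
      fin_cases i <;> fin_cases k <;> fin_cases l <;> fin_cases m <;>
        simp [hypUnits, ← mul_assoc, -ι_sq_scalar, h1, h2, h3, h4] <;>
        simp [mul_assoc, -ι_sq_scalar, h3, h4])
    (by simp [hypUnits, hypF_mul_hypE])
    (fun a i k => by
      have h1 := commute_toCentralizer_hypE Q a
      have h2 := commute_toCentralizer_hypF Q a
      fin_cases i <;> fin_cases k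
      exacts [h1.mul_right h2, h1, h2, h2.mul_right h1])

lemma ofMatrix_apply (N : Matrix (Fin 2) (Fin 2) (CliffordAlgebra Q)) : ofMatrix Q N =
    toCentralizer Q (N 0 0) * (hypE Q * hypF Q) + toCentralizer Q (N 0 1) * hypE Q +
      (toCentralizer Q (N 1 0) * hypF Q + toCentralizer Q (N 1 1) * (hypF Q * hypE Q)) := by
  rw [ofMatrix, matrixUnitsLift_apply]
  simp [hypUnits]

lemma ofMatrix_toMatrix_ι (v : (R × R) × M) : ofMatrix Q (toMatrix Q (ι _ v)) = ι _ v := by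
  have hv : v = v.1.1 • ((1, 0), 0) + v.1.2 • ((0, 1), 0) + (0, v.2) := by
    ext <;> simp
  have h : ι (addHyperbolic Q) v = algebraMap R _ v.1.1 * hypE Q +
      algebraMap R _ v.1.2 * hypF Q + ι _ (0, v.2) := by
    conv_lhs => rw [hv]
    simp only [map_add, map_smul, Algebra.smul_def]
  rw [toMatrix_ι, ofMatrix_apply, h]
  simp only [Matrix.of_apply, Matrix.cons_val', Matrix.cons_val_zero, Matrix.cons_val_one,
    Matrix.cons_val_fin_one, map_neg, AlgHom.commutes, toCentralizer_ι]
  have h2 : ι (addHyperbolic Q) (0, v.2) = ι _ (0, v.2) * hypChir Q * (hypE Q * hypF Q)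
      - ι _ (0, v.2) * hypChir Q * (hypF Q * hypE Q) := by
    rw [← mul_sub, ← hypChir, mul_assoc, hypChir_mul_self, mul_one]
  conv_rhs => rw [h2]
  noncomm_ring

lemma toMatrix_toCentralizer (a : CliffordAlgebra Q) :
    toMatrix Q (toCentralizer Q a) = Matrix.scalar (Fin 2) a := by
  suffices h : (toMatrix Q).comp (toCentralizer Q) = Matrix.scalarAlgHom (Fin 2) R from
    DFunLike.congr_fun h a
  ext m i k
  fin_cases i <;> fin_cases k <;>
    simp [toCentralizer_ι, toMatrix_ι, hypChir, Matrix.scalar_apply]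

/-- Adding a hyperbolic plane to a quadratic form replaces its Clifford algebra by the `2 × 2`
matrices over it. -/
noncomputable def addHyperbolicEquiv :
    CliffordAlgebra (addHyperbolic Q) ≃ₐ[R] Matrix (Fin 2) (Fin 2) (CliffordAlgebra Q) :=
  AlgEquiv.ofAlgHom (toMatrix Q) (ofMatrix Q)
    (by
      ext N i k
      fin_cases i <;> fin_cases k <;>
        simp [ofMatrix_apply, toMatrix_toCentralizer, toMatrix_ι, Matrix.scalar_apply,
          Matrix.mul_apply])
    (CliffordAlgebra.hom_ext (LinearMap.ext fun v => ofMatrix_toMatrix_ι Q v))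

end CliffordAlgebra

/-- The isometry splitting off a hyperbolic plane, using `x² + y² = (x + iy)(x - iy)`. -/
noncomputable def QcSuccSuccIsometry (n : ℕ) :
    (Qc (n + 2)).IsometryEquiv (addHyperbolic (Qc n)) where
  toFun v := ((v 0 + Complex.I * v 1, v 0 - Complex.I * v 1), fun i => v i.succ.succ)
  invFun w := Fin.cons ((w.1.1 + w.1.2) / 2)
    (Fin.cons (-Complex.I * (w.1.1 - w.1.2) / 2) w.2 : Fin (n + 1) → ℂ)
  map_add' v w := by ext <;> simp <;> ring
  map_smul' r v := by ext <;> simp <;> ring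
  left_inv v := by
    ext i
    refine Fin.cases ?_ (fun i => Fin.cases ?_ (fun i => ?_) i) i
    · simp
    · simp only [Fin.cons_succ, Fin.cons_zero]
      rw [Fin.succ_zero_eq_one]
      linear_combination -v 1 * Complex.I_sq
    · simp
  right_inv w := by
    have h1 : (Fin.cons ((w.1.1 + w.1.2) / 2)
        (Fin.cons (-Complex.I * (w.1.1 - w.1.2) / 2) w.2 : Fin (n + 1) → ℂ) : Fin (n + 2) → ℂ) 1 =
        -Complex.I * (w.1.1 - w.1.2) / 2 := rfl
    ext
    · simp only [h1, Fin.cons_zero]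
      linear_combination -(w.1.1 - w.1.2) / 2 * Complex.I_sq
    · simp only [h1, Fin.cons_zero]
      linear_combination (w.1.1 - w.1.2) / 2 * Complex.I_sq
    · simp
  map_app' v := by
    simp only [addHyperbolic_apply, Qc, QuadraticMap.weightedSumSquares_apply,
      Fin.sum_univ_succ (n := n + 1), Fin.sum_univ_succ (n := n), Fin.succ_zero_eq_one, smul_eq_mul]
    linear_combination -v 1 ^ 2 * Complex.I_sq

/-- The `1 × 1` complex matrices are the scalars. -/
noncomputable def algEquivMatrixFinOne : ℂ ≃ₐ[ℂ] Matrix (Fin 1) (Fin 1) ℂ :=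
  AlgEquiv.ofBijective (Algebra.ofId ℂ _)
    ⟨(algebraMap ℂ (Matrix (Fin 1) (Fin 1) ℂ)).injective, fun N => ⟨N 0 0, by
      ext i k
      simp [Subsingleton.elim i 0, Subsingleton.elim k 0, Algebra.ofId_apply,
        Matrix.algebraMap_matrix_apply]⟩⟩

/-- The isometry of `Qc 0` with the zero form on a point. -/
noncomputable def QcZeroIsometry : (Qc 0).IsometryEquiv (0 : QuadraticForm ℂ Unit) where
  toLinearEquiv := 0
  map_app' v := by simp [Qc]

/-- `Cl^c(2k) ≅ M_{2^k}(ℂ)` as ℂ-algebras. -/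
theorem clc_even_iso_matrix (k : ℕ) :
    Nonempty (Clc (2 * k) ≃ₐ[ℂ] Matrix (Fin (2 ^ k)) (Fin (2 ^ k)) ℂ) := by
  induction k with
  | zero =>
    exact ⟨(equivOfIsometry QcZeroIsometry).trans <|
      CliffordAlgebraRing.equiv.trans algEquivMatrixFinOne⟩
  | succ k ih =>
    obtain ⟨e⟩ := ih
    exact ⟨(equivOfIsometry (QcSuccSuccIsometry (2 * k))).trans <|
      (addHyperbolicEquiv (Qc (2 * k))).trans <| (AlgEquiv.mapMatrix e).trans <|
      (Matrix.compAlgEquiv (Fin 2) (Fin (2 ^ k)) ℂ ℂ).trans <|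
      Matrix.reindexAlgEquiv ℂ ℂ (finProdFinEquiv.trans (finCongr (pow_succ' 2 k).symm))⟩
end

section
/- For every natural number k there is an isomorphism of ℂ-algebras Cl^c(2k+1) ≅ M_{2^k}(ℂ) × M_{2^k}(ℂ): the complex Clifford algebra on 2k+1 generators is a direct sum of two copies of the matrix algebra of complex 2^k × 2^k matrices. -/
/-- A family of pairwise anticommuting elements with square one. -/
def IsCliffordFamily {A : Type*} [Ring A] [Algebra ℂ A] {n : ℕ} (x : Fin n → A) : Prop :=
  ∀ i j, x i * x j + x j * x i = algebraMap ℂ A (if i = j then 2 else 0)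

namespace IsCliffordFamily

variable {A B : Type*} [Ring A] [Algebra ℂ A] [Ring B] [Algebra ℂ B] {n : ℕ}

theorem mul_self {x : Fin n → A} (hx : IsCliffordFamily x) (i : Fin n) : x i * x i = 1 := by
  have h := hx i i
  rw [if_pos rfl, ← two_smul ℂ, Algebra.algebraMap_eq_smul_one] at h
  exact smul_right_injective A (two_ne_zero (α := ℂ)) h

theorem mul_swap {x : Fin n → A} (hx : IsCliffordFamily x) {i j : Fin n} (hij : i ≠ j) :
    x i * x j = -(x j * x i) := by
  have h := hx i j
  rw [if_neg hij, map_zero] at h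
  exact eq_neg_of_add_eq_zero_left h

theorem map {x : Fin n → A} (hx : IsCliffordFamily x) (f : A →ₐ[ℂ] B) :
    IsCliffordFamily (f ∘ x) := by
  intro i j
  simpa using congrArg f (hx i j)

theorem comp_injective {m : ℕ} {x : Fin n → A} (hx : IsCliffordFamily x) {g : Fin m → Fin n}
    (hg : Function.Injective g) : IsCliffordFamily (x ∘ g) := by
  intro i j
  simpa [hg.eq_iff] using hx (g i) (g j)

theorem cons {x : Fin n → A} (hx : IsCliffordFamily x) {e : A} (he : e * e = 1)
    (hex : ∀ i, e * x i + x i * e = 0) :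
    IsCliffordFamily (Fin.cons e x : Fin (n + 1) → A) := by
  intro i j
  obtain rfl | ⟨i, rfl⟩ := i.eq_zero_or_eq_succ <;> obtain rfl | ⟨j, rfl⟩ := j.eq_zero_or_eq_succ
  · simp [he, one_add_one_eq_two, map_ofNat (algebraMap ℂ A) 2]
  · simpa [(Fin.succ_ne_zero j).symm] using hex j
  · simpa [add_comm] using hex i
  · simpa using hx i j

theorem adjoin_range_le {x : Fin (n + 1) → A} (hx : IsCliffordFamily x) :
    Subalgebra.toSubmodule (Algebra.adjoin ℂ (Set.range x)) ≤
      Subalgebra.toSubmodule (Algebra.adjoin ℂ (Set.range (x ∘ Fin.succ))) ⊔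
        (Subalgebra.toSubmodule (Algebra.adjoin ℂ (Set.range (x ∘ Fin.succ)))).map
          (LinearMap.mulRight ℂ (x 0)) := by
  rw [Algebra.adjoin_eq_span ℂ (Set.range x), Submodule.span_le]
  intro a ha
  induction ha using Submonoid.closure_induction_right with
  | one => exact Submodule.mem_sup_left (one_mem (Algebra.adjoin ℂ _))
  | mul_right a _ b hb ih =>
    obtain ⟨i, rfl⟩ := hb
    obtain ⟨s, hs, _, ⟨t, ht, rfl⟩, rfl⟩ := Submodule.mem_sup.1 ih
    rw [add_mul]
    obtain rfl | ⟨j, rfl⟩ := i.eq_zero_or_eq_succ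
    · rw [LinearMap.mulRight_apply, mul_assoc, hx.mul_self, mul_one, add_comm (s * x 0) t]
      exact Submodule.add_mem_sup ht ⟨s, hs, rfl⟩
    · have hj : x j.succ ∈ Algebra.adjoin ℂ (Set.range (x ∘ Fin.succ)) :=
        Algebra.subset_adjoin ⟨j, rfl⟩
      rw [LinearMap.mulRight_apply, mul_assoc t, hx.mul_swap (Fin.succ_ne_zero j).symm]
      refine Submodule.add_mem_sup (Subalgebra.mul_mem _ hs hj)
        ⟨-(t * x j.succ), Subalgebra.neg_mem _ (Subalgebra.mul_mem _ ht hj), ?_⟩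
      simp [mul_assoc]

theorem finrank_adjoin_le {x : Fin n → A} (hx : IsCliffordFamily x) :
    Module.Finite ℂ (Subalgebra.toSubmodule (Algebra.adjoin ℂ (Set.range x))) ∧
      Module.finrank ℂ (Subalgebra.toSubmodule (Algebra.adjoin ℂ (Set.range x))) ≤ 2 ^ n := by
  induction n with
  | zero =>
    rw [Set.range_eq_empty, Algebra.adjoin_empty, Algebra.toSubmodule_bot, Submodule.one_eq_span]
    exact ⟨inferInstance, by simpa using finrank_span_le_card ({1} : Set A)⟩
  | succ n ih =>
    obtain ⟨_, hrank⟩ := ih (hx.comp_injective (Fin.succ_injective n))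
    refine ⟨Submodule.finiteDimensional_of_le hx.adjoin_range_le,
      (Submodule.finrank_mono hx.adjoin_range_le).trans
        ((Submodule.finrank_add_le_finrank_add_finrank _ _).trans ?_)⟩
    have := Submodule.finrank_map_le (LinearMap.mulRight ℂ (x 0))
      (Subalgebra.toSubmodule (Algebra.adjoin ℂ (Set.range (x ∘ Fin.succ))))
    rw [pow_succ]
    omega

theorem linearCombination_mul_self {x : Fin n → A} (hx : IsCliffordFamily x) (v : Fin n → ℂ) :
    Fintype.linearCombination ℂ x v * Fintype.linearCombination ℂ x v =
      algebraMap ℂ A (Qc n v) := by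
  apply smul_right_injective A (two_ne_zero (α := ℂ))
  have h (i j : Fin n) : (v i * v j) • (x i * x j) + (v j * v i) • (x j * x i) =
      algebraMap ℂ A (v i * v j * if i = j then 2 else 0) := by
    rw [mul_comm (v j), ← smul_add, hx, map_mul, Algebra.smul_def]
  simp only [Fintype.linearCombination_apply, two_smul, Finset.sum_mul_sum, smul_mul_smul_comm]
  conv_lhs => enter [2]; rw [Finset.sum_comm]
  simp only [← Finset.sum_add_distrib, h, ← map_sum, ← map_add]
  congr 1
  simp [Qc, QuadraticMap.weightedSumSquares_apply, ← Finset.sum_add_distrib, mul_two]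

end IsCliffordFamily

theorem polar_Qc {n : ℕ} (v w : Fin n → ℂ) :
    QuadraticMap.polar (Qc n) v w = 2 * ∑ i, v i * w i := by
  simp only [QuadraticMap.polar, Qc, QuadraticMap.weightedSumSquares_apply,
    ← Finset.sum_sub_distrib, Finset.mul_sum]
  refine Finset.sum_congr rfl fun i _ => ?_
  simp
  ring

theorem isCliffordFamily_ι (n : ℕ) :
    IsCliffordFamily fun i : Fin n => CliffordAlgebra.ι (Qc n) (Pi.single i 1) := by
  intro i j
  rw [CliffordAlgebra.ι_mul_ι_add_swap, polar_Qc]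
  congr 1
  simp [Pi.single_apply, eq_comm]

theorem adjoin_range_ι_single (n : ℕ) :
    Algebra.adjoin ℂ
      (Set.range fun i : Fin n => CliffordAlgebra.ι (Qc n) (Pi.single i 1)) = ⊤ := by
  rw [eq_top_iff, ← CliffordAlgebra.adjoin_range_ι, Algebra.adjoin_le_iff]
  rintro _ ⟨v, rfl⟩
  rw [← Finset.univ_sum_single v, map_sum]
  refine sum_mem fun i _ => ?_
  rw [← mul_one (v i), ← smul_eq_mul, Pi.single_smul, map_smul]
  exact Subalgebra.smul_mem _ (Algebra.subset_adjoin (Set.mem_range_self i)) _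

theorem finite_cliffordAlgebra_Qc (n : ℕ) : Module.Finite ℂ (CliffordAlgebra (Qc n)) := by
  have h := (isCliffordFamily_ι n).finrank_adjoin_le.1
  rw [adjoin_range_ι_single, Algebra.top_toSubmodule] at h
  exact Module.Finite.equiv Submodule.topEquiv

theorem finrank_cliffordAlgebra_Qc_le (n : ℕ) :
    Module.finrank ℂ (CliffordAlgebra (Qc n)) ≤ 2 ^ n := by
  have h := (isCliffordFamily_ι n).finrank_adjoin_le.2
  rwa [adjoin_range_ι_single, Algebra.top_toSubmodule, finrank_top] at h

/-- `A` is generated by a Clifford family of length `n`. -/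
def CliffordGenerated (n : ℕ) (A : Type*) [Ring A] [Algebra ℂ A] : Prop :=
  ∃ x : Fin n → A, IsCliffordFamily x ∧ Algebra.adjoin ℂ (Set.range x) = ⊤

namespace CliffordGenerated

variable {A B : Type*} [Ring A] [Algebra ℂ A] [Ring B] [Algebra ℂ B] {n : ℕ}

theorem of_surjective (h : CliffordGenerated n A) (f : A →ₐ[ℂ] B) (hf : Function.Surjective f) :
    CliffordGenerated n B := by
  obtain ⟨x, hx, hgen⟩ := h
  refine ⟨f ∘ x, hx.map f, ?_⟩
  rw [Set.range_comp, ← AlgHom.map_adjoin, hgen, Algebra.map_top, AlgHom.range_eq_top]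
  exact hf

theorem nonempty_algEquiv (h : CliffordGenerated n A) (hrank : 2 ^ n ≤ Module.finrank ℂ A) :
    Nonempty (CliffordAlgebra (Qc n) ≃ₐ[ℂ] A) := by
  obtain ⟨x, hx, hgen⟩ := h
  let f := CliffordAlgebra.lift (Qc n)
    ⟨Fintype.linearCombination ℂ x, hx.linearCombination_mul_self⟩
  have hf : Function.Surjective f := by
    rw [← AlgHom.range_eq_top, eq_top_iff, ← hgen, Algebra.adjoin_le_iff]
    rintro _ ⟨i, rfl⟩
    exact ⟨CliffordAlgebra.ι _ (Pi.single i 1), by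
      simp [f, Fintype.linearCombination_apply_single]⟩
  have := finite_cliffordAlgebra_Qc n
  have : Module.Finite ℂ A := Module.Finite.of_surjective f.toLinearMap hf
  have hdim : Module.finrank ℂ (CliffordAlgebra (Qc n)) = Module.finrank ℂ A :=
    le_antisymm ((finrank_cliffordAlgebra_Qc_le n).trans hrank)
      (LinearMap.finrank_le_finrank_of_surjective (f := f.toLinearMap) hf)
  exact ⟨AlgEquiv.ofBijective f
    ⟨(LinearMap.injective_iff_surjective_of_finrank_eq_finrank (f := f.toLinearMap) hdim).2 hf,
      hf⟩⟩

theorem matrix_two (h : CliffordGenerated n A) :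
    CliffordGenerated (n + 2) (Matrix (Fin 2) (Fin 2) A) := by
  obtain ⟨x, hx, hgen⟩ := h
  let c : A := algebraMap ℂ A Complex.I
  have hc : c * c = -1 := by simp [c, ← map_mul]
  let p : Matrix (Fin 2) (Fin 2) A := !![0, 1; 1, 0]
  let q : Matrix (Fin 2) (Fin 2) A := !![0, -c; c, 0]
  let d (a : A) : Matrix (Fin 2) (Fin 2) A := !![a, 0; 0, -a]
  let y : Fin (n + 2) → Matrix (Fin 2) (Fin 2) A := Fin.cons p (Fin.cons q fun i => d (x i))
  have hcomm (a : A) : c * a = a * c := Algebra.commutes _ _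
  have halg (z : ℂ) : algebraMap ℂ (Matrix (Fin 2) (Fin 2) A) z =
      !![algebraMap ℂ A z, 0; 0, algebraMap ℂ A z] := by
    ext i j
    fin_cases i <;> fin_cases j <;> simp [Matrix.algebraMap_matrix_apply]
  have h0 : !![(0 : A), 0; 0, 0] = 0 := by
    ext i j
    fin_cases i <;> fin_cases j <;> rfl
  refine ⟨y, ?_, ?_⟩
  · have hdx : IsCliffordFamily fun i => d (x i) := by
      intro i j
      rw [halg, ← hx i j]
      simp [d]
    exact (hdx.cons (by simp [q, hc, Matrix.one_fin_two]) (by simp [q, d, hcomm, h0])).cons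
      (by simp [p, Matrix.one_fin_two])
      (Fin.cases (by simp [p, q, h0]) (by simp [p, d, h0]))
  · set S := Algebra.adjoin ℂ (Set.range y)
    have hp : p ∈ S := Algebra.subset_adjoin ⟨0, rfl⟩
    have hq : q ∈ S := Algebra.subset_adjoin ⟨1, rfl⟩
    have hd (i : Fin n) : d (x i) ∈ S := Algebra.subset_adjoin ⟨i.succ.succ, rfl⟩
    have hz : d 1 ∈ S := by
      have : d 1 = (-Complex.I) • (p * q) := by
        rw [Algebra.smul_def, halg, map_neg]
        change d 1 = !![-c, 0; 0, -c] * (p * q)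
        simp [d, p, q, hc]
      rw [this]
      exact S.smul_mem (mul_mem hp hq) _
    have hdiag (a : A) : !![a, 0; 0, a] ∈ S := by
      have ha : a ∈ Algebra.adjoin ℂ (Set.range x) := hgen ▸ Algebra.mem_top
      induction ha using Algebra.adjoin_induction with
      | mem a ha =>
        obtain ⟨i, rfl⟩ := ha
        simpa [d, Matrix.mul_fin_two] using mul_mem hz (hd i)
      | algebraMap z => rw [← halg]; exact S.algebraMap_mem z
      | add a b _ _ ha hb => simpa using add_mem ha hb
      | mul a b _ _ ha hb => simpa [Matrix.mul_fin_two] using mul_mem ha hb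
    have hE : !![(1 : A), 0; 0, 0] ∈ S := by
      have : !![(1 : A), 0; 0, 0] = (2⁻¹ : ℂ) • (1 + d 1) := by
        have h2 : (1 : A) = (2⁻¹ : ℂ) • (1 + 1) := by
          rw [← two_smul ℂ, inv_smul_smul₀ two_ne_zero]
        simp [d, Matrix.one_fin_two, ← h2]
      rw [this]
      exact S.smul_mem (add_mem (one_mem _) hz) _
    rw [eq_top_iff]
    intro M _
    have hM : M = !![M 0 0, 0; 0, M 0 0] * !![1, 0; 0, 0] +
        !![M 0 1, 0; 0, M 0 1] * (!![1, 0; 0, 0] * p) +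
        !![M 1 0, 0; 0, M 1 0] * (p * !![1, 0; 0, 0]) +
        !![M 1 1, 0; 0, M 1 1] * (p * !![1, 0; 0, 0] * p) := by
      conv_lhs => rw [Matrix.eta_fin_two M]
      simp [p]
    rw [hM]
    exact add_mem (add_mem (add_mem (mul_mem (hdiag _) hE) (mul_mem (hdiag _) (mul_mem hE hp)))
      (mul_mem (hdiag _) (mul_mem hp hE))) (mul_mem (hdiag _) (mul_mem (mul_mem hp hE) hp))

theorem matrix_prod (k : ℕ) : CliffordGenerated (2 * k + 1)
    (Matrix (Fin (2 ^ k)) (Fin (2 ^ k)) ℂ × Matrix (Fin (2 ^ k)) (Fin (2 ^ k)) ℂ) := by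
  induction k with
  | zero =>
    refine ⟨fun _ => (1, -1), fun i j => ?_, ?_⟩
    · have : i = j := Subsingleton.elim (α := Fin 1) i j
      simp [this, one_add_one_eq_two, Prod.ext_iff, map_ofNat (algebraMap ℂ _) 2]
    · rw [eq_top_iff]
      rintro ⟨M, N⟩ -
      let u : Matrix (Fin (2 ^ 0)) (Fin (2 ^ 0)) ℂ × Matrix (Fin (2 ^ 0)) (Fin (2 ^ 0)) ℂ := (1, -1)
      have h : (M, N) = algebraMap ℂ _ ((M 0 0 + N 0 0) / 2) +
          ((M 0 0 - N 0 0) / 2) • u := by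
        ext i j <;>
        · rw [Subsingleton.elim (α := Fin 1) i 0, Subsingleton.elim (α := Fin 1) j 0]
          simp [u, Matrix.algebraMap_matrix_apply]
          ring
      rw [h]
      exact add_mem (Subalgebra.algebraMap_mem _ _)
        (Subalgebra.smul_mem _ (Algebra.subset_adjoin (Set.mem_range_self (0 : Fin 1))) _)
  | succ k ih =>
    let m := Fin (2 ^ k)
    let e : Fin 2 × m ≃ Fin (2 ^ (k + 1)) :=
      finProdFinEquiv.trans (finCongr (pow_succ' 2 k).symm)
    let g : Matrix (Fin 2) (Fin 2) (Matrix m m ℂ) ≃ₐ[ℂ]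
        Matrix (Fin (2 ^ (k + 1))) (Fin (2 ^ (k + 1))) ℂ :=
      (Matrix.compAlgEquiv (Fin 2) m ℂ ℂ).trans (Matrix.reindexAlgEquiv ℂ ℂ e)
    refine ih.matrix_two.of_surjective
      ((g.toAlgHom.comp (AlgHom.fst ℂ _ _).mapMatrix).prod
        (g.toAlgHom.comp (AlgHom.snd ℂ _ _).mapMatrix)) ?_
    rintro ⟨M, N⟩
    refine ⟨Matrix.of fun i j => (g.symm M i j, g.symm N i j), Prod.ext ?_ ?_⟩
    · exact g.apply_symm_apply M
    · exact g.apply_symm_apply N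

end CliffordGenerated

/-- `Cl^c(2k+1) ≅ M_{2^k}(ℂ) × M_{2^k}(ℂ)` as ℂ-algebras. -/
theorem clc_odd_iso_matrix_prod (k : ℕ) :
    Nonempty (Clc (2 * k + 1) ≃ₐ[ℂ]
      (Matrix (Fin (2 ^ k)) (Fin (2 ^ k)) ℂ × Matrix (Fin (2 ^ k)) (Fin (2 ^ k)) ℂ)) := by
  refine (CliffordGenerated.matrix_prod k).nonempty_algEquiv (le_of_eq ?_)
  simp [Module.finrank_prod, Module.finrank_matrix]
  ring
end

section
/- Let p, q be natural numbers with n = p + q even. Then the center of the real Clifford algebra Cl(p,q) is trivial: it consists exactly of the scalars ℝ·1 (i.e., the center equals the bottom subalgebra). -/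
open Quaternion

section AnticommutingGenerators

variable {K A I : Type*} [Field K] [Ring A] [Algebra K A] {e : I → A} {ε : I → K}

/-- Words in a generating family span the algebra. -/
theorem span_list_prod_eq_top (hgen : Algebra.adjoin K (Set.range e) = ⊤) :
    Submodule.span K (Set.range fun l : List I => (l.map e).prod) = ⊤ := by
  rw [eq_top_iff, ← Algebra.top_toSubmodule, ← hgen, Algebra.adjoin_eq_span]
  refine Submodule.span_mono fun x hx => ?_
  rw [SetLike.mem_coe, ← FreeMonoid.mrange_lift] at hx
  obtain ⟨l, rfl⟩ := hx
  exact ⟨l.toList, (FreeMonoid.lift_apply e l).symm⟩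

variable [DecidableEq I]

/-- Moving a generator past a word in anticommuting generators costs a sign. -/
theorem list_prod_mul_eq_neg_one_pow_smul (hanti : ∀ i j, i ≠ j → e i * e j = -(e j * e i))
    (l : List I) (i : I) :
    (l.map e).prod * e i = (-1 : K) ^ (l.length + l.count i) • (e i * (l.map e).prod) := by
  induction l with
  | nil => simp
  | cons j l ih =>
    rw [List.map_cons, List.prod_cons, mul_assoc, ih, mul_smul_comm, ← mul_assoc (e j),
      ← mul_assoc (e i)]
    by_cases hij : j = i
    · subst hij
      rw [List.length_cons, List.count_cons_self,
        show l.length + 1 + (l.count j + 1) = l.length + l.count j + 2 by ring,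
        pow_add _ _ 2, neg_one_sq, mul_one]
    · rw [hanti j i hij, List.length_cons, List.count_cons_of_ne hij,
        show l.length + 1 + l.count i = l.length + l.count i + 1 by ring, pow_succ, neg_mul,
        mul_neg_one, neg_smul, smul_neg, mul_assoc]

/-- A word in which every anticommuting generator occurs an even number of times is a scalar. -/
theorem list_prod_mem_bot_of_forall_even_count (hsq : ∀ i, e i * e i = algebraMap K A (ε i))
    (hanti : ∀ i j, i ≠ j → e i * e j = -(e j * e i)) (l : List I)
    (hl : ∀ i, Even (l.count i)) : (l.map e).prod ∈ (⊥ : Subalgebra K A) := by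
  induction hn : l.length using Nat.strong_induction_on generalizing l with
  | _ n ih =>
    cases l with
    | nil => simp
    | cons i t =>
      have hi := hl i
      rw [List.count_cons_self, Nat.even_add_one, Nat.not_even_iff_odd] at hi
      obtain ⟨a, b, rfl⟩ := List.append_of_mem (List.count_pos_iff.mp hi.pos)
      have hab : ((a ++ b).map e).prod ∈ (⊥ : Subalgebra K A) := by
        refine ih _ ?_ (a ++ b) (fun j => ?_) rfl
        · simp only [← hn, List.length_cons, List.length_append]
          omega
        · have hj := hl j
          simp only [List.count_cons, List.count_append] at hj ⊢
          grind
      have hprod : ((i :: (a ++ i :: b)).map e).prod =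
          ((-1 : K) ^ (a.length + a.count i) * ε i) • ((a ++ b).map e).prod := by
        simp only [List.map_cons, List.map_append, List.prod_cons, List.prod_append]
        rw [← mul_assoc (a.map e).prod, list_prod_mul_eq_neg_one_pow_smul (K := K) hanti,
          smul_mul_assoc, mul_smul_comm, ← mul_assoc (e i), ← mul_assoc (e i), hsq, mul_smul,
          Algebra.smul_def (ε i), mul_assoc]
      rw [hprod]
      exact Subalgebra.smul_mem _ hab _

/-- A central element is a combination of those words that commute with all generators in `T`. -/
theorem mem_span_list_prod_of_mem_center (h2 : (2 : K) ≠ 0) (hε : ∀ i, ε i ≠ 0)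
    (hsq : ∀ i, e i * e i = algebraMap K A (ε i))
    (hanti : ∀ i j, i ≠ j → e i * e j = -(e j * e i))
    (hgen : Algebra.adjoin K (Set.range e) = ⊤) {x : A} (hx : x ∈ Subalgebra.center K A)
    (T : Finset I) :
    x ∈ Submodule.span K
      ((fun l : List I => (l.map e).prod) '' {l | ∀ i ∈ T, Even (l.length + l.count i)}) := by
  induction T using Finset.induction_on with
  | empty =>
    have h : {l : List I | ∀ i ∈ (∅ : Finset I), Even (l.length + l.count i)} = Set.univ := by
      simp
    rw [h, Set.image_univ, span_list_prod_eq_top hgen]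
    exact Submodule.mem_top
  | insert i T _ ih =>
    let E : A →ₗ[K] A := (2 : K)⁻¹ • (LinearMap.id +
      (ε i)⁻¹ • (LinearMap.mulLeft K (e i) ∘ₗ LinearMap.mulRight K (e i)))
    have hE (y : A) (s : K) (hy : y * e i = s • (e i * y)) : E y = ((2 : K)⁻¹ * (1 + s)) • y := by
      have : E y = (2 : K)⁻¹ • (y + (ε i)⁻¹ • (e i * (y * e i))) := rfl
      rw [this, hy, mul_smul_comm, ← mul_assoc, hsq, ← Algebra.smul_def, smul_comm s,
        inv_smul_smul₀ (hε i), mul_smul, add_smul, one_smul]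
    have hEx : E x = x := by
      rw [hE x 1 (by rw [one_smul, Subalgebra.mem_center_iff.mp hx]), one_add_one_eq_two,
        inv_mul_cancel₀ h2, one_smul]
    rw [← hEx]
    refine (Submodule.span_le.mpr ?_ : _ ≤ Submodule.comap E (Submodule.span K _)) ih
    rintro _ ⟨l, hl, rfl⟩
    have hEl := hE _ _ (list_prod_mul_eq_neg_one_pow_smul (K := K) hanti l i)
    rw [SetLike.mem_coe, Submodule.mem_comap]
    rw [hEl]
    rcases Nat.even_or_odd (l.length + l.count i) with hev | hodd
    · refine Submodule.smul_mem _ _ (Submodule.subset_span ⟨l, fun j hj => ?_, rfl⟩)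
      rcases Finset.mem_insert.mp hj with rfl | hj
      · exact hev
      · exact hl j hj
    · rw [hodd.neg_one_pow, add_neg_cancel, mul_zero, zero_smul]
      exact Submodule.zero_mem _

/-- An algebra generated by an even number of anticommuting elements with nonzero scalar squares
has trivial center. -/
theorem center_eq_bot_of_anticommuting_generators [Fintype I] (hI : Even (Fintype.card I))
    (h2 : (2 : K) ≠ 0) (hε : ∀ i, ε i ≠ 0) (hsq : ∀ i, e i * e i = algebraMap K A (ε i))
    (hanti : ∀ i j, i ≠ j → e i * e j = -(e j * e i))
    (hgen : Algebra.adjoin K (Set.range e) = ⊤) : Subalgebra.center K A = ⊥ := by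
  refine eq_bot_iff.mpr fun x hx => ?_
  refine Submodule.span_le (p := Subalgebra.toSubmodule (⊥ : Subalgebra K A)).mpr ?_
    (mem_span_list_prod_of_mem_center h2 hε hsq hanti hgen hx Finset.univ)
  rintro _ ⟨l, hl, rfl⟩
  have hlen : Even l.length := by
    have hsum : Even (∑ i : I, (l.length + l.count i)) :=
      Finset.even_sum _ fun i hi => hl i hi
    have hcount : ∑ i : I, l.count i = l.length := by
      simpa using Multiset.sum_count_eq_card (s := Finset.univ) (m := (l : Multiset I)) (by simp)
    rw [Finset.sum_add_distrib, hcount, Finset.sum_const, Finset.card_univ, smul_eq_mul,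
      Nat.even_add] at hsum
    exact hsum.mp (hI.mul_right _)
  exact list_prod_mem_bot_of_forall_even_count hsq hanti l fun i =>
    (Nat.even_add.mp (hl i (Finset.mem_univ i))).mp hlen

end AnticommutingGenerators

theorem CliffordAlgebra.adjoin_range_ι_basis {R M I : Type*} [CommRing R] [AddCommGroup M]
    [Module R M] (Q : QuadraticForm R M) (b : Module.Basis I R M) :
    Algebra.adjoin R (Set.range fun i => CliffordAlgebra.ι Q (b i)) = ⊤ := by
  rw [eq_top_iff, ← CliffordAlgebra.adjoin_range_ι, Algebra.adjoin_le_iff]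
  rintro _ ⟨v, rfl⟩
  have hv : v ∈ Submodule.span R (Set.range b) := b.span_eq ▸ Submodule.mem_top
  refine Submodule.span_le (p := (Subalgebra.toSubmodule (Algebra.adjoin R
    (Set.range fun i => CliffordAlgebra.ι Q (b i)))).comap (CliffordAlgebra.ι Q)).mpr ?_ hv
  rintro _ ⟨i, rfl⟩
  exact Algebra.subset_adjoin ⟨i, rfl⟩

theorem Qpq_single (p q : ℕ) (i : Fin (p + q)) :
    Qpq p q (Pi.single i 1) = if (i : ℕ) < p then 1 else -1 := by
  simp [Qpq, QuadraticMap.weightedSumSquares_apply, Pi.single_apply]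

theorem Qpq_isOrtho_single (p q : ℕ) {i j : Fin (p + q)} (hij : i ≠ j) :
    (Qpq p q).IsOrtho (Pi.single i 1) (Pi.single j 1) := by
  rw [QuadraticMap.isOrtho_def]
  simp only [Qpq, QuadraticMap.weightedSumSquares_apply, ← Finset.sum_add_distrib]
  refine Finset.sum_congr rfl fun k _ => ?_
  by_cases hki : k = i
  · subst hki
    simp [hij]
  · simp [hki]

/-- When `n = p + q` is even, the center of `Cl(p,q)` is trivial: it equals the
bottom subalgebra `ℝ·1`. -/
theorem cl_center_trivial_of_even (p q : ℕ) (h : Even (p + q)) :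
    Subalgebra.center ℝ (Cl p q) = ⊥ := by
  change Subalgebra.center ℝ (CliffordAlgebra (Qpq p q)) = ⊥
  refine center_eq_bot_of_anticommuting_generators
    (e := fun i => CliffordAlgebra.ι (Qpq p q) (Pi.single i 1))
    (ε := fun i : Fin (p + q) => if (i : ℕ) < p then (1 : ℝ) else -1)
    (by simpa using h) two_ne_zero (fun i => ?_) (fun i => ?_) (fun i j hij => ?_) ?_
  · split_ifs <;> norm_num
  · rw [CliffordAlgebra.ι_sq_scalar, Qpq_single]
  · exact CliffordAlgebra.ι_mul_ι_comm_of_isOrtho (Qpq_isOrtho_single p q hij)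
  · simpa only [Pi.basisFun_apply] using
      CliffordAlgebra.adjoin_range_ι_basis (Qpq p q) (Pi.basisFun ℝ (Fin (p + q)))
end
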